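/- arXiv:2503.10090 — 5 statements merged into one kernel-verified Lean document; each statement's English description precedes it below -/
import Mathlib

section
/- Let l ≥ 3 and let k_1,…,k_l be positive integers with gcd(k_1,…,k_l) = 1; define d_m, k'_m, d'_m and the integers N_i^{(m)} (2 ≤ m ≤ l−1, 1 ≤ i ≤ m, with k'_1 N_1^{(m)} + ⋯ + k'_m N_m^{(m)} = 1) as follows: d_m = gcd(k_1,…,k_m), k'_1 = k_1/d_2, k'_m = k_m/d_m for 2 ≤ m ≤ l, d'_m = d_m/d_{m+1} for 2 ≤ m ≤ l−1. Consider the l × (l−1) integer matrix J whose column j has entries: column 1 is (k'_2, −k'_1, 0, …, 0)ᵀ; for 2 ≤ j ≤ l−2, column j has entries k'_{j+1} N_i^{(j)} in rows i ≤ j, entry −d'_j in row j+1, and zeros below; column l−1 has entries k_l N_i^{(l−1)} in rows i ≤ l−1 and entry −d_{l−1} in row l. Then J, viewed as a matrix over ℚ (or ℝ), has rank l−1; equivalently, its l−1 columns are linearly independent. -/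
open scoped BigOperators

/-- Let `l ≥ 3` and `k₁,…,k_l` positive integers with
`gcd(k₁,…,k_l) = 1`; with `d_m = gcd(k₁,…,k_m)`, `k'₁ = k₁/d₂`, `k'_m = k_m/d_m`
(`2 ≤ m ≤ l`), `d'_m = d_m/d_{m+1}` (`2 ≤ m ≤ l-1`) and Bézout coefficients `N_i⁽ᵐ⁾`
with `k'₁ N₁⁽ᵐ⁾ + ⋯ + k'_m N_m⁽ᵐ⁾ = 1`, the `l × (l-1)` integer matrix `J` described
below (the Jacobian matrix of the map `φ` of the Appendix), viewed as a matrix over `ℚ`,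
has rank `l - 1`, i.e. its `l-1` columns are linearly independent. -/
theorem stmt2 (l : ℕ) (hl : 3 ≤ l)
    (k d k' d' : ℕ → ℤ) (N : ℕ → ℕ → ℤ)
    (hk : ∀ i, 1 ≤ i → i ≤ l → 0 < k i)
    (hgcd : Finset.gcd (Finset.Icc 1 l) k = 1)
    (hd : ∀ m, 1 ≤ m → m ≤ l → d m = Finset.gcd (Finset.Icc 1 m) k)
    (hk'1 : k' 1 = k 1 / d 2)
    (hk'm : ∀ m, 2 ≤ m → m ≤ l → k' m = k m / d m)
    (hd' : ∀ m, 2 ≤ m → m ≤ l - 1 → d' m = d m / d (m + 1))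
    (hN : ∀ m, 2 ≤ m → m ≤ l - 1 → ∑ i ∈ Finset.Icc 1 m, k' i * N m i = 1)
    (J : Matrix (Fin l) (Fin (l - 1)) ℤ)
    (hJ : ∀ (i : Fin l) (j : Fin (l - 1)),
      J i j =
        if (j : ℕ) + 1 = 1 then
          -- column 1 : (k'₂, -k'₁, 0, …, 0)ᵀ
          (if (i : ℕ) + 1 = 1 then k' 2 else if (i : ℕ) + 1 = 2 then -(k' 1) else 0)
        else if (j : ℕ) + 1 ≤ l - 2 then
          -- columns 2 ≤ c ≤ l-2, with c = j+1 : entries k'_{c+1} N_m⁽ᶜ⁾ in rows m ≤ c,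
          -- entry -d'_c in row c+1, zeros below
          (if (i : ℕ) + 1 ≤ (j : ℕ) + 1 then k' ((j : ℕ) + 2) * N ((j : ℕ) + 1) ((i : ℕ) + 1)
           else if (i : ℕ) + 1 = (j : ℕ) + 2 then -(d' ((j : ℕ) + 1)) else 0)
        else
          -- column l-1 : entries k_l N_m⁽ˡ⁻¹⁾ in rows m ≤ l-1, entry -d_{l-1} in row l
          (if (i : ℕ) + 1 ≤ l - 1 then k l * N (l - 1) ((i : ℕ) + 1) else -(d (l - 1)))) :
    (J.map (fun x : ℤ => (x : ℚ))).rank = l - 1 := by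
  obtain ⟨n, rfl⟩ : ∃ n, l = n + 1 := ⟨l - 1, by omega⟩
  have hdpos : ∀ m, 1 ≤ m → m ≤ n + 1 → 0 < d m := by
    intro m h1 h2
    have hdvd : d m ∣ k 1 := by
      rw [hd m h1 h2]
      exact Finset.gcd_dvd (Finset.mem_Icc.2 ⟨le_refl 1, h1⟩)
    have hne : d m ≠ 0 := by
      intro h
      rw [h, zero_dvd_iff] at hdvd
      have := hk 1 le_rfl (by omega)
      omega
    have hnn : 0 ≤ d m := by
      rw [hd m h1 h2, ← Finset.normalize_gcd, ← Int.abs_eq_normalize]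
      exact abs_nonneg _
    omega
  have hk1 : k' 1 ≠ 0 := by
    have hdvd : d 2 ∣ k 1 := by
      rw [hd 2 (by omega) (by omega)]
      exact Finset.gcd_dvd (Finset.mem_Icc.2 ⟨le_refl 1, by omega⟩)
    rw [hk'1]
    exact (Int.ediv_pos_of_pos_of_dvd (hk 1 le_rfl (by omega))
      (hdpos 2 (by omega) (by omega)).le hdvd).ne'
  have hd'ne : ∀ m, 2 ≤ m → m ≤ n → d' m ≠ 0 := by
    intro m h1 h2
    have hdvd : d (m + 1) ∣ d m := by
      rw [hd m (by omega) (by omega), hd (m + 1) (by omega) (by omega)]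
      exact Finset.gcd_mono (Finset.Icc_subset_Icc_right (by omega))
    rw [hd' m h1 (by omega)]
    exact (Int.ediv_pos_of_pos_of_dvd (hdpos m (by omega) (by omega))
      (hdpos (m + 1) (by omega) (by omega)).le hdvd).ne'
  change (J.map (fun x : ℤ => (x : ℚ))).rank = n
  change Matrix (Fin (n + 1)) (Fin n) ℤ at J
  set A : Matrix (Fin (n + 1)) (Fin n) ℚ := J.map (fun x : ℤ => (x : ℚ)) with hA
  let B : Matrix (Fin n) (Fin n) ℚ := A.submatrix Fin.succ id
  have htri : B.BlockTriangular id := by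
    intro i j hij
    have hij' : (j : ℕ) < i := hij
    have hi := i.isLt
    have h0 : J i.succ j = 0 := by
      rw [hJ]
      simp only [Fin.val_succ]
      split_ifs <;> first | rfl | omega
    simp [B, hA, h0]
  have hdiag : ∀ i, B i i ≠ 0 := by
    intro i
    have hi := i.isLt
    have h0 : J i.succ i ≠ 0 := by
      rw [hJ]
      simp only [Fin.val_succ]
      split_ifs <;> first | omega | skip
      · exact neg_ne_zero.2 (hd'ne _ (by omega) (by omega))
      · exact neg_ne_zero.2 (hdpos _ (by omega) (by omega)).ne'
    simpa [B, hA] using h0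
  have hdet : B.det ≠ 0 := by
    rw [Matrix.det_of_upperTriangular htri]
    exact Finset.prod_ne_zero_iff.2 fun i _ => hdiag i
  have hB : B.rank = n := by
    simpa using Matrix.rank_of_isUnit B ((Matrix.isUnit_iff_isUnit_det B).2 hdet.isUnit)
  apply le_antisymm
  · simpa using A.rank_le_width
  · exact hB.ge.trans (Matrix.rank_submatrix_le A Fin.succ id)
end

section
/- Let l ≥ 2 and let k_1,…,k_l be positive integers, and set d = gcd(k_1,…,k_l). Then the closed subgroup T_{k_1,…,k_l} of the torus 𝕋^l, with the subspace topology, is homeomorphic to the product (Fin d) × 𝕋^{l−1}, i.e. to the disjoint union of d copies of the (l−1)-dimensional torus. -/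
open scoped Real BigOperators

theorem aux_two {A : Type*} [AddCommGroup A] [TopologicalSpace A] [IsTopologicalAddGroup A]
    (m n : ℕ) : ∃ Ψ : (A × A) ≃ₜ (A × A), ∀ x : A × A,
      (m : ℤ) • x.1 + (n : ℤ) • x.2 = ((Nat.gcd m n : ℕ) : ℤ) • (Ψ x).1 := by
  by_cases hg : Nat.gcd m n = 0
  · obtain ⟨rfl, rfl⟩ := Nat.gcd_eq_zero_iff.mp hg
    exact ⟨Homeomorph.refl _, fun x => by simp⟩
  · obtain ⟨m', hm⟩ := Nat.gcd_dvd_left m n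
    obtain ⟨n', hn⟩ := Nat.gcd_dvd_right m n
    have hb := Nat.gcd_eq_gcd_ab m n
    set u := Nat.gcdA m n
    set v := Nat.gcdB m n
    set g := Nat.gcd m n
    have hg' : (g : ℤ) ≠ 0 := by exact_mod_cast hg
    have hmz : (m : ℤ) = g * m' := by exact_mod_cast hm
    have hnz : (n : ℤ) = g * n' := by exact_mod_cast hn
    have h1 : (m' : ℤ) * u + n' * v = 1 := by
      apply mul_left_cancel₀ hg'
      rw [hmz, hnz] at hb
      linarith
    refine ⟨{ toFun := fun x => ((m' : ℤ) • x.1 + (n' : ℤ) • x.2, -v • x.1 + u • x.2)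
              invFun := fun y => (u • y.1 - (n' : ℤ) • y.2, v • y.1 + (m' : ℤ) • y.2)
              left_inv := ?_
              right_inv := ?_
              continuous_toFun := by fun_prop
              continuous_invFun := by fun_prop }, ?_⟩
    · rintro ⟨x, y⟩
      refine Prod.ext ?_ ?_
      · change u • ((m' : ℤ) • x + (n' : ℤ) • y) - (n' : ℤ) • (-v • x + u • y) = x
        calc _ = ((m' : ℤ) * u + n' * v) • x := by module
          _ = x := by rw [h1, one_smul]
      · change v • ((m' : ℤ) • x + (n' : ℤ) • y) + (m' : ℤ) • (-v • x + u • y) = y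
        calc _ = ((m' : ℤ) * u + n' * v) • y := by module
          _ = y := by rw [h1, one_smul]
    · rintro ⟨x, y⟩
      refine Prod.ext ?_ ?_
      · change (m' : ℤ) • (u • x - (n' : ℤ) • y) + (n' : ℤ) • (v • x + (m' : ℤ) • y) = x
        calc _ = ((m' : ℤ) * u + n' * v) • x := by module
          _ = x := by rw [h1, one_smul]
      · change -v • (u • x - (n' : ℤ) • y) + u • (v • x + (m' : ℤ) • y) = y
        calc _ = ((m' : ℤ) * u + n' * v) • y := by module
          _ = y := by rw [h1, one_smul]
    · rintro ⟨x, y⟩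
      change (m : ℤ) • x + (n : ℤ) • y = (g : ℤ) • ((m' : ℤ) • x + (n' : ℤ) • y)
      rw [hmz, hnz]
      module

theorem aux_gcd_succ (n : ℕ) (k : Fin (n + 1) → ℕ) :
    Finset.univ.gcd k = Nat.gcd (k 0) (Finset.univ.gcd fun i : Fin n => k i.succ) := by
  rw [Fin.univ_succ, Finset.gcd_cons, Finset.map_eq_image, Finset.gcd_image]
  rfl

theorem aux_many {A : Type*} [AddCommGroup A] [TopologicalSpace A] [IsTopologicalAddGroup A]
    (n : ℕ) : ∀ k : Fin (n + 1) → ℕ, ∃ Φ : (Fin (n + 1) → A) ≃ₜ (A × (Fin n → A)), ∀ x,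
      ∑ i, (k i : ℤ) • x i = ((Finset.univ.gcd k : ℕ) : ℤ) • (Φ x).1 := by
  induction n with
  | zero =>
    intro k
    refine ⟨(Fin.consEquivL ℤ (fun _ : Fin 1 => A)).symm.toHomeomorph, fun x => ?_⟩
    rw [aux_gcd_succ]
    simp
  | succ n ih =>
    intro k
    obtain ⟨φ, hφ⟩ := ih (fun i => k i.succ)
    obtain ⟨ψ, hψ⟩ := aux_two (A := A) (k 0) (Finset.univ.gcd fun i : Fin (n + 1) => k i.succ)
    refine ⟨(Fin.consEquivL ℤ (fun _ : Fin (n + 2) => A)).symm.toHomeomorph.trans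
      (((Homeomorph.refl A).prodCongr φ).trans
      ((Homeomorph.prodAssoc A A (Fin n → A)).symm.trans
      ((ψ.prodCongr (Homeomorph.refl _)).trans
      ((Homeomorph.prodAssoc A A (Fin n → A)).trans
      ((Homeomorph.refl A).prodCongr
        (Fin.consEquivL ℤ (fun _ : Fin (n + 1) => A)).toHomeomorph))))), fun x => ?_⟩
    rw [Fin.sum_univ_succ, hφ (fun i => x i.succ), aux_gcd_succ (n + 1) k]
    exact hψ (x 0, (φ fun i => x i.succ).1)

theorem aux_tors {p : ℝ} [hp : Fact (0 < p)] (d : ℕ) (hd : 0 < d) :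
    Nonempty ({u : AddCircle p | (d : ℤ) • u = 0} ≃ₜ Fin d) := by
  have hp0 : 0 < p := hp.out
  have hd' : (0 : ℝ) < d := by exact_mod_cast hd
  have key : ∀ u : AddCircle p, (d : ℤ) • u = 0 ↔
      ∃ m < d, (((m : ℝ) / d * p : ℝ) : AddCircle p) = u := fun u => by
    rw [natCast_zsmul, AddCircle.nsmul_eq_zero_iff hd]
  let f : Fin d → {u : AddCircle p | (d : ℤ) • u = 0} := fun m =>
    ⟨(((m : ℕ) : ℝ) / d * p : ℝ), (key _).2 ⟨m, m.2, rfl⟩⟩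
  have hf : Function.Bijective f := by
    constructor
    · intro a b hab
      have h := congrArg Subtype.val hab
      have hm : ∀ c : Fin d, ((c : ℕ) : ℝ) / d * p ∈ Set.Ico (0 : ℝ) (0 + p) := fun c => by
        have hc : ((c : ℕ) : ℝ) / d < 1 := by
          rw [div_lt_one hd']; exact_mod_cast c.2
        refine ⟨by positivity, ?_⟩
        nlinarith
      have h2 := (AddCircle.coe_eq_coe_iff_of_mem_Ico (hm a) (hm b)).1 h
      have h3 : ((a : ℕ) : ℝ) = (b : ℕ) := by
        field_simp at h2
        exact h2
      exact Fin.ext (by exact_mod_cast h3)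
    · rintro ⟨u, hu⟩
      obtain ⟨m, hm, rfl⟩ := (key u).1 hu
      exact ⟨⟨m, hm⟩, rfl⟩
  have : Finite {u : AddCircle p | (d : ℤ) • u = 0} := Finite.of_surjective f hf.2
  exact ⟨Homeomorph.ofDiscrete (Equiv.ofBijective f hf).symm⟩

/-- For `l ≥ 2` and positive integers `k₁,…,k_l` with
`d = gcd(k₁,…,k_l)`, the closed subgroup
`T_{k₁,…,k_l} = {θ ∈ 𝕋^l | k₁ • θ 1 + ⋯ + k_l • θ l = 0}` of the torus `𝕋^l`
(`𝕋 = ℝ/2πℤ`, subspace topology) is homeomorphic to `(Fin d) × 𝕋^{l-1}`, the disjoint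
union of `d` copies of the `(l-1)`-dimensional torus. -/
theorem stmt3 (l : ℕ) (hl : 2 ≤ l) (k : Fin l → ℕ) (hk : ∀ i, 0 < k i)
    (d : ℕ) (hd : d = Finset.univ.gcd k) :
    Nonempty
      (({θ : Fin l → AddCircle (2 * Real.pi) | ∑ i, (k i : ℤ) • θ i = 0} :
          Set (Fin l → AddCircle (2 * Real.pi))) ≃ₜ
        (Fin d × (Fin (l - 1) → AddCircle (2 * Real.pi)))) := by
  obtain ⟨n, rfl⟩ : ∃ n, l = n + 1 := ⟨l - 1, by omega⟩
  have : Fact (0 < 2 * Real.pi) := ⟨Real.two_pi_pos⟩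
  have hd0 : 0 < d := by
    rcases Nat.eq_zero_or_pos d with h | h
    · rw [h] at hd
      have := Finset.gcd_eq_zero_iff.1 hd.symm 0 (Finset.mem_univ _)
      exact absurd this (hk 0).ne'
    · exact h
  obtain ⟨Φ, hΦ⟩ := aux_many (A := AddCircle (2 * Real.pi)) n k
  obtain ⟨τ⟩ := aux_tors (p := 2 * Real.pi) d hd0
  refine ⟨Homeomorph.trans (Homeomorph.subtype (q := fun y => y ∈
    ({u : AddCircle (2 * Real.pi) | (d : ℤ) • u = 0} ×ˢ
      (Set.univ : Set (Fin n → AddCircle (2 * Real.pi))))) Φ fun x => ?_)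
    ((Homeomorph.Set.prod _ _).trans (τ.prodCongr (Homeomorph.Set.univ _)))⟩
  rw [Set.mem_ofPred_eq, hΦ x, ← hd]
  simp
end

section
/- Let l ≥ 2 and let k_1,…,k_l be positive integers, and set d = gcd(k_1,…,k_l). Then the topological space T_{k_1,…,k_l} (with the subspace topology from 𝕋^l) has exactly d connected components. -/
open scoped Real BigOperators

theorem bezout_aux {ι : Type*} (s : Finset ι) (k : ι → ℕ) :
    ∃ b : ι → ℤ, ∑ i ∈ s, (k i : ℤ) * b i = (s.gcd k : ℕ) := by
  classical
  induction s using Finset.induction_on with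
  | empty => exact ⟨0, by simp⟩
  | insert a s ha ih =>
    obtain ⟨b, hb⟩ := ih
    refine ⟨fun i => if i = a then Nat.gcdA (k a) (s.gcd k)
      else b i * Nat.gcdB (k a) (s.gcd k), ?_⟩
    rw [Finset.sum_insert ha, Finset.gcd_insert]
    have h1 : ∑ i ∈ s, (k i : ℤ) * (if i = a then Nat.gcdA (k a) (s.gcd k)
      else b i * Nat.gcdB (k a) (s.gcd k)) = (∑ i ∈ s, (k i : ℤ) * b i) *
        Nat.gcdB (k a) (s.gcd k) := by
      rw [Finset.sum_mul]
      refine Finset.sum_congr rfl fun i hi => ?_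
      have hne : i ≠ a := fun h => ha (h ▸ hi)
      rw [if_neg hne, mul_assoc]
    rw [h1, hb]
    simp only [if_true]
    exact (Nat.gcd_eq_gcd_ab _ _).symm

theorem card_torsion_aux (p : ℝ) [hp : Fact (0 < p)] (d : ℕ) (hd : 0 < d) :
    Nat.card {u : AddCircle p // d • u = 0} = d := by
  have hd' : (0 : ℝ) < d := by exact_mod_cast hd
  have hp' := hp.out
  let g : Fin d → {u : AddCircle p // d • u = 0} := fun m =>
    ⟨(((m : ℕ) / d * p : ℝ) : AddCircle p), (AddCircle.nsmul_eq_zero_iff hd).2 ⟨m, m.2, rfl⟩⟩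
  have hmem : ∀ m : Fin d, ((m : ℕ) / d * p : ℝ) ∈ Set.Ico (0 : ℝ) (0 + p) := by
    intro m
    have hm : ((m : ℕ) : ℝ) < d := by exact_mod_cast m.2
    refine ⟨by positivity, ?_⟩
    rw [zero_add]
    have : ((m : ℕ) : ℝ) / d < 1 := (div_lt_one hd').2 hm
    nlinarith
  have hg : Function.Bijective g := by
    constructor
    · intro m n h
      have h1 := congrArg Subtype.val h
      have h2 := (AddCircle.coe_eq_coe_iff_of_mem_Ico (hmem m) (hmem n)).1 h1
      have h3 := mul_right_cancel₀ hp'.ne' h2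
      rw [div_left_inj' hd'.ne'] at h3
      exact Fin.ext (by exact_mod_cast h3)
    · rintro ⟨u, hu⟩
      obtain ⟨m, hm, h⟩ := (AddCircle.nsmul_eq_zero_iff hd).1 hu
      exact ⟨⟨m, hm⟩, Subtype.ext h⟩
  rw [← Nat.card_congr (Equiv.ofBijective g hg), Nat.card_fin]

theorem fiber_aux (p : ℝ) {l : ℕ} (q : Fin l → ℤ) (b : Fin l → ℤ)
    (hb : ∑ i, q i * b i = 1) (c : ℝ) :
    {θ : Fin l → AddCircle p | ∑ i, q i • θ i = (c : AddCircle p)} =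
      (fun (x : Fin l → ℝ) (i : Fin l) => ((x i : ℝ) : AddCircle p)) ''
        {x | ∑ i, (q i : ℝ) * x i = c} := by
  have hb' : ∑ i, (q i : ℝ) * b i = 1 := by exact_mod_cast hb
  have key : ∀ x : Fin l → ℝ, ((∑ i, (q i : ℝ) * x i : ℝ) : AddCircle p) =
      ∑ i, q i • ((x i : ℝ) : AddCircle p) := by
    intro x
    have : (∑ i, (q i : ℝ) * x i : ℝ) = ∑ i, q i • x i := by simp
    rw [this]
    exact map_sum (QuotientAddGroup.mk' (AddSubgroup.zmultiples p)) _ _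
  ext θ
  constructor
  · intro h
    have hs : ∀ i, ∃ x : ℝ, (x : AddCircle p) = θ i := fun i =>
      QuotientAddGroup.mk_surjective (θ i)
    choose x hx using hs
    have h1 : ((∑ i, (q i : ℝ) * x i - c : ℝ) : AddCircle p) = 0 := by
      rw [AddCircle.coe_sub, key, sub_eq_zero]
      simpa [hx] using h
    obtain ⟨n, hn⟩ := (AddCircle.coe_eq_zero_iff p).1 h1
    refine ⟨fun i => x i - (n * b i : ℤ) • p, ?_, ?_⟩
    · have : ∑ i, (q i : ℝ) * (x i - (n * b i : ℤ) • p) =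
          ∑ i, (q i : ℝ) * x i - (∑ i, (q i : ℝ) * b i) * (n * p) := by
        rw [Finset.sum_mul, ← Finset.sum_sub_distrib]
        refine Finset.sum_congr rfl fun i _ => ?_
        simp only [zsmul_eq_mul]; push_cast; ring
      rw [zsmul_eq_mul] at hn
      simp only [Set.mem_ofPred_eq]
      rw [this, hb']
      linarith
    · funext i
      simp only
      rw [AddCircle.coe_sub, AddCircle.coe_zsmul, AddCircle.coe_period, smul_zero, sub_zero, hx]
  · rintro ⟨x, hx, rfl⟩
    simp only [Set.mem_ofPred_eq] at hx ⊢
    rw [← key, hx]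

theorem fiber_preconn (p : ℝ) {l : ℕ} (q : Fin l → ℤ) (b : Fin l → ℤ)
    (hb : ∑ i, q i * b i = 1) (u : AddCircle p) :
    IsPreconnected {θ : Fin l → AddCircle p | ∑ i, q i • θ i = u} := by
  obtain ⟨c, rfl⟩ := QuotientAddGroup.mk_surjective u
  have := fiber_aux p q b hb c
  refine this ▸ ?_
  apply IsPreconnected.image
  · apply Convex.isPreconnected
    intro x hx y hy s t _ _ hst
    simp only [Set.mem_ofPred_eq] at hx hy ⊢
    have : ∑ i, (q i : ℝ) * (s • x + t • y) i =
        s * (∑ i, (q i : ℝ) * x i) + t * ∑ i, (q i : ℝ) * y i := by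
      rw [Finset.mul_sum, Finset.mul_sum, ← Finset.sum_add_distrib]
      refine Finset.sum_congr rfl fun i _ => ?_
      simp only [Pi.add_apply, Pi.smul_apply, smul_eq_mul]; ring
    rw [this, hx, hy, ← add_mul, hst, one_mul]
  · refine Continuous.continuousOn (continuous_pi fun i => ?_)
    exact (AddCircle.continuous_mk' p).comp (continuous_apply i)

theorem card_cc_aux {X Y : Type*} [TopologicalSpace X] [TopologicalSpace Y]
    [TotallyDisconnectedSpace Y] (f : X → Y) (hf : Continuous f)
    (hs : Function.Surjective f) (hc : ∀ y, IsPreconnected (f ⁻¹' {y})) :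
    Nat.card (ConnectedComponents X) = Nat.card Y := by
  refine Nat.card_congr (Equiv.ofBijective hf.connectedComponentsLift ⟨?_, ?_⟩)
  · intro a b
    obtain ⟨x, rfl⟩ := ConnectedComponents.surjective_coe a
    obtain ⟨y, rfl⟩ := ConnectedComponents.surjective_coe b
    intro h
    rw [ConnectedComponents.coe_eq_coe']
    exact (hc (f y)).subset_connectedComponent rfl h
  · intro y
    obtain ⟨x, rfl⟩ := hs y
    exact ⟨x, rfl⟩

/-- For `l ≥ 2` and positive integers `k₁,…,k_l` with
`d = gcd(k₁,…,k_l)`, the topological space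
`T_{k₁,…,k_l} = {θ ∈ 𝕋^l | k₁ • θ 1 + ⋯ + k_l • θ l = 0}` (subspace topology from the
torus `𝕋^l`, `𝕋 = ℝ/2πℤ`) has exactly `d` connected components. -/
theorem stmt4 (l : ℕ) (hl : 2 ≤ l) (k : Fin l → ℕ) (hk : ∀ i, 0 < k i)
    (d : ℕ) (hd : d = Finset.univ.gcd k) :
    Nat.card
      (ConnectedComponents
        ({θ : Fin l → AddCircle (2 * Real.pi) | ∑ i, (k i : ℤ) • θ i = 0} :
          Set (Fin l → AddCircle (2 * Real.pi)))) = d := by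
  have hp : Fact (0 < 2 * Real.pi) := ⟨Real.two_pi_pos⟩
  have hdvd : ∀ i, d ∣ k i := fun i => hd ▸ Finset.gcd_dvd (Finset.mem_univ i)
  have hd0 : 0 < d := Nat.pos_of_dvd_of_pos (hdvd ⟨0, by omega⟩) (hk _)
  choose q hq using hdvd
  obtain ⟨b, hb⟩ := bezout_aux Finset.univ k
  rw [← hd] at hb
  have hb1 : ∑ i, (q i : ℤ) * b i = 1 := by
    have h : (d : ℤ) * ∑ i, (q i : ℤ) * b i = d * 1 := by
      rw [mul_one, Finset.mul_sum]
      refine Eq.trans ?_ hb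
      refine Finset.sum_congr rfl fun i _ => ?_
      rw [hq i]; push_cast; ring
    exact mul_left_cancel₀ (by exact_mod_cast hd0.ne') h
  have hmul : ∀ θ : Fin l → AddCircle (2 * Real.pi),
      d • ∑ i, (q i : ℤ) • θ i = ∑ i, (k i : ℤ) • θ i := by
    intro θ
    rw [Finset.smul_sum]
    refine Finset.sum_congr rfl fun i _ => ?_
    rw [hq i, ← natCast_zsmul, smul_smul]; push_cast; rfl
  let f : ({θ : Fin l → AddCircle (2 * Real.pi) | ∑ i, (k i : ℤ) • θ i = 0} :
      Set (Fin l → AddCircle (2 * Real.pi))) → {u : AddCircle (2 * Real.pi) // d • u = 0} :=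
    fun θ => ⟨∑ i, (q i : ℤ) • θ.1 i, (hmul θ.1).trans θ.2⟩
  have hfin : Finite {u : AddCircle (2 * Real.pi) // d • u = 0} :=
    (AddCircle.finite_torsion (2 * Real.pi) hd0).to_subtype
  rw [← card_torsion_aux (2 * Real.pi) d hd0]
  have hf : Continuous f := by
    refine Continuous.subtype_mk ?_ _
    refine continuous_finsetSum _ fun i _ => ?_
    exact ((continuous_apply i).comp continuous_subtype_val).zsmul _
  refine card_cc_aux f hf ?_ ?_
  · rintro ⟨u, hu⟩
    have h : ∑ i, (q i : ℤ) • (b i • u) = u := by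
      simp only [smul_smul]
      rw [← Finset.sum_smul, hb1, one_smul]
    refine ⟨⟨fun i => b i • u, ?_⟩, Subtype.ext h⟩
    change ∑ i, (k i : ℤ) • (b i • u) = 0
    rw [← hmul fun i => b i • u, h, hu]
  · rintro ⟨u, hu⟩
    rw [← Topology.IsInducing.subtypeVal.isPreconnected_image]
    convert fiber_preconn (2 * Real.pi) (fun i => (q i : ℤ)) b hb1 u using 1
    ext θ
    constructor
    · rintro ⟨t, ht, rfl⟩
      exact congrArg Subtype.val ht
    · intro h
      have h' : ∑ i, (q i : ℤ) • θ i = u := h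
      exact ⟨⟨θ, by change _ = _; rw [← hmul, h', hu]⟩, Subtype.ext h, rfl⟩
end

section
/- Let l ≥ 1 and let k_1,…,k_l be positive integers, and set d = gcd(k_1,…,k_l) and k̃_i = k_i/d. For 0 ≤ j ≤ d−1 set T^{(j)} := {θ ∈ 𝕋^l : k̃_1θ_1 + ⋯ + k̃_lθ_l = [2πj/d]}, where [x] denotes the class of x ∈ ℝ in 𝕋. Then T_{k_1,…,k_l} is the union of the pairwise disjoint sets T^{(0)},…,T^{(d−1)}, and for each 0 ≤ j ≤ d−1 the translation of 𝕋^l by the element ([2πj/(d·k̃_1)], 0, …, 0) maps T^{(0)} bijectively onto T^{(j)}. -/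
open scoped Real BigOperators

lemma aux_eq (d : ℕ) (hd : 0 < d) (a b : ℝ) :
    ((a : ℝ) : AddCircle (2 * Real.pi)) = (b : ℝ) ↔ ∃ n : ℤ, a = b + n * (2 * Real.pi) := by
  rw [← sub_eq_zero, ← AddCircle.coe_sub, AddCircle.coe_eq_zero_iff]
  constructor
  · rintro ⟨n, hn⟩
    refine ⟨n, ?_⟩
    rw [zsmul_eq_mul] at hn
    linarith
  · rintro ⟨n, hn⟩
    refine ⟨n, ?_⟩
    rw [zsmul_eq_mul]
    linarith

lemma aux_tors_s5 (d : ℕ) (hd : 0 < d) (x : AddCircle (2 * Real.pi)) :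
    (d : ℤ) • x = 0 ↔ ∃ j ∈ Finset.range d,
      x = ((2 * Real.pi * j / d : ℝ) : AddCircle (2 * Real.pi)) := by
  have hd' : (d : ℝ) ≠ 0 := by positivity
  have hdz : (d : ℤ) ≠ 0 := by positivity
  constructor
  · induction x using QuotientAddGroup.induction_on with
    | H r =>
    intro h
    change (d : ℤ) • ((r : ℝ) : AddCircle (2 * Real.pi)) = 0 at h
    rw [← AddCircle.coe_zsmul, AddCircle.coe_eq_zero_iff] at h
    obtain ⟨m, hm⟩ := h
    simp only [zsmul_eq_mul, Int.cast_natCast] at hm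
    have h0 := Int.emod_nonneg m hdz
    have h1 := Int.emod_lt_of_pos m (by exact_mod_cast hd : (0 : ℤ) < d)
    refine ⟨(m % d).toNat, by simp; omega, ?_⟩
    refine (aux_eq d hd _ _).2 ⟨m / d, ?_⟩
    have h2 : (((m % d).toNat : ℕ) : ℝ) = ((m % d : ℤ) : ℝ) := by
      exact_mod_cast congrArg (Int.cast : ℤ → ℝ) (Int.toNat_of_nonneg h0)
    have h3 : ((m % d : ℤ) : ℝ) + d * ((m / d : ℤ) : ℝ) = m := by
      exact_mod_cast Int.emod_add_mul_ediv m d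
    rw [h2]
    field_simp
    rw [← h3] at hm
    linarith
  · rintro ⟨j, -, rfl⟩
    rw [← AddCircle.coe_zsmul, AddCircle.coe_eq_zero_iff]
    refine ⟨j, ?_⟩
    simp only [zsmul_eq_mul, Int.cast_natCast]
    field_simp

/-- Let `l ≥ 1`, let `k₁,…,k_l` be positive integers,
`d = gcd(k₁,…,k_l)` and `k̃ᵢ = kᵢ/d`.  For `0 ≤ j ≤ d-1` let
`T⁽ʲ⁾ = {θ ∈ 𝕋^l | k̃₁ • θ 1 + ⋯ + k̃_l • θ l = [2πj/d]}` (`𝕋 = ℝ/2πℤ`).  Then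
`T_{k₁,…,k_l}` is the union of the pairwise disjoint sets `T⁽⁰⁾,…,T⁽ᵈ⁻¹⁾`, and for each
`0 ≤ j ≤ d-1` the translation of `𝕋^l` by `([2πj/(d·k̃₁)], 0, …, 0)` maps `T⁽⁰⁾`
bijectively onto `T⁽ʲ⁾`. -/
theorem stmt5 (l : ℕ) (hl : 1 ≤ l) (k : Fin l → ℕ) (hk : ∀ i, 0 < k i)
    (d : ℕ) (hd : d = Finset.univ.gcd k)
    (T : Set (Fin l → AddCircle (2 * Real.pi)))
    (hT : T = {θ | ∑ i, (k i : ℤ) • θ i = 0})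
    (Tj : ℕ → Set (Fin l → AddCircle (2 * Real.pi)))
    (hTj : ∀ j, Tj j = {θ | ∑ i, ((k i / d : ℕ) : ℤ) • θ i =
        ((2 * Real.pi * j / d : ℝ) : AddCircle (2 * Real.pi))}) :
    T = (⋃ j ∈ Finset.range d, Tj j) ∧
    (∀ j₁ ∈ Finset.range d, ∀ j₂ ∈ Finset.range d, j₁ ≠ j₂ → Disjoint (Tj j₁) (Tj j₂)) ∧
    (∀ j ∈ Finset.range d,
      Set.BijOn
        (fun θ => θ + (fun i : Fin l => if (i : ℕ) = 0 then
          (((2 * Real.pi * j) / ((d : ℝ) * ((k ⟨0, by omega⟩ / d : ℕ) : ℝ)) : ℝ) :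
            AddCircle (2 * Real.pi)) else 0))
        (Tj 0) (Tj j)) := by
  have hdk : ∀ i, d ∣ k i := fun i => hd ▸ Finset.gcd_dvd (Finset.mem_univ i)
  have hdpos : 0 < d := Nat.pos_of_dvd_of_pos (hdk ⟨0, by omega⟩) (hk _)
  have hd' : (d : ℝ) ≠ 0 := by positivity
  refine ⟨?_, ?_, ?_⟩
  · ext θ
    have hs : ∑ i, (k i : ℤ) • θ i = (d : ℤ) • ∑ i, ((k i / d : ℕ) : ℤ) • θ i := by
      rw [Finset.smul_sum]
      refine Finset.sum_congr rfl fun i _ => ?_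
      rw [smul_smul]
      congr 1
      exact_mod_cast (Nat.mul_div_cancel' (hdk i)).symm
    simp only [hT, hTj, Set.mem_iUnion, Set.mem_setOf_eq, exists_prop]
    rw [hs, aux_tors_s5 d hdpos]
  · intro j₁ h₁ j₂ h₂ hne
    rw [Set.disjoint_left]
    intro θ ha hb
    rw [hTj, Set.mem_setOf_eq] at ha hb
    rw [ha] at hb
    obtain ⟨n, hn⟩ := (aux_eq d hdpos _ _).1 hb
    have hpi := Real.pi_pos
    field_simp at hn
    have hz : (j₁ : ℤ) = j₂ + d * n := by
      have : (j₁ : ℝ) = j₂ + d * n := by linarith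
      exact_mod_cast this
    rw [Finset.mem_range] at h₁ h₂
    apply hne
    have h3 : (j₁ : ℤ) % d = j₂ % d := by rw [hz]; simp
    rw [Int.emod_eq_of_lt (by omega) (by omega), Int.emod_eq_of_lt (by omega) (by omega)] at h3
    exact_mod_cast h3
  · intro j _
    set v : Fin l → AddCircle (2 * Real.pi) := (fun i : Fin l => if (i : ℕ) = 0 then
          (((2 * Real.pi * j) / ((d : ℝ) * ((k ⟨0, by omega⟩ / d : ℕ) : ℝ)) : ℝ) :
            AddCircle (2 * Real.pi)) else 0) with hv
    have hk0 : 0 < k ⟨0, by omega⟩ / d := Nat.div_pos (Nat.le_of_dvd (hk _) (hdk _)) hdpos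
    have hk0' : ((k ⟨0, by omega⟩ / d : ℕ) : ℝ) ≠ 0 := by exact_mod_cast hk0.ne'
    have hsv : ∑ i, ((k i / d : ℕ) : ℤ) • v i =
        ((2 * Real.pi * j / d : ℝ) : AddCircle (2 * Real.pi)) := by
      rw [Finset.sum_eq_single (⟨0, by omega⟩ : Fin l)]
      · simp only [hv, if_true]
        rw [← AddCircle.coe_zsmul]
        congr 1
        rw [zsmul_eq_mul, Int.cast_natCast]
        field_simp
      · intro b _ hb
        have : (b : ℕ) ≠ 0 := fun h => hb (Fin.ext h)
        simp [hv, this]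
      · simp
    have key : ∀ θ : Fin l → AddCircle (2 * Real.pi), θ + v ∈ Tj j ↔ θ ∈ Tj 0 := by
      intro θ
      rw [hTj, hTj, Set.mem_setOf_eq, Set.mem_setOf_eq]
      simp only [Pi.add_apply, smul_add, Finset.sum_add_distrib]
      rw [hsv]
      simp
    refine ⟨fun θ h => (key θ).2 h, fun a _ b _ h => add_right_cancel h, fun θ h => ?_⟩
    refine ⟨θ - v, (key _).1 (by simpa using h), by simp⟩
end

section
/- Let l ≥ 1, let k_1,…,k_l be positive integers and let λ ∈ ℝ. Consider the closed subset S := {θ ∈ 𝕋^l : cos(λ + k_1θ_1 + ⋯ + k_lθ_l) ≥ 0} of the torus 𝕋^l (this is well defined since cosine is 2π-periodic, so cos of an element of 𝕋 makes sense), and the closed subset C := {θ ∈ 𝕋^l : k_1θ_1 + ⋯ + k_lθ_l = [−λ]}, where [−λ] denotes the class of −λ in 𝕋. Then C ⊆ S and the inclusion map C ↪ S is a homotopy equivalence. -/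
open scoped Real BigOperators


/-- The continuous section: representative in `[-π/2, π/2]`. -/
noncomputable def rr (x : AddCircle (2 * Real.pi)) : ℝ :=
  Real.arcsin (Real.sin_periodic.lift x)

lemma rr_coe_aux (y : ℝ) : rr (y : AddCircle (2 * Real.pi)) = Real.arcsin (Real.sin y) := rfl

lemma rr_continuous : Continuous rr :=
  Real.continuous_arcsin.comp Real.Angle.continuous_sin

lemma coe_rr (x : AddCircle (2 * Real.pi)) (hx : 0 ≤ Real.cos_periodic.lift x) :
    ((rr x : ℝ) : AddCircle (2 * Real.pi)) = x := by
  obtain ⟨y, hy, rfl⟩ : ∃ y : ℝ, |y| ≤ π / 2 ∧ (y : AddCircle (2 * Real.pi)) = x :=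
    ⟨Real.Angle.toReal x, Real.Angle.cos_nonneg_iff_abs_toReal_le_pi_div_two.1 hx,
      Real.Angle.coe_toReal x⟩
  rw [abs_le] at hy
  rw [rr_coe_aux, Real.arcsin_sin (by linarith) hy.2]

lemma cos_mul_rr (x : AddCircle (2 * Real.pi)) (t : ℝ) (h0 : 0 ≤ t) (h1 : t ≤ 1) :
    0 ≤ Real.cos (t * rr x) := by
  have a := Real.neg_pi_div_two_le_arcsin (Real.sin_periodic.lift x)
  have b := Real.arcsin_le_pi_div_two (Real.sin_periodic.lift x)
  change -(π / 2) ≤ rr x at a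
  change rr x ≤ π / 2 at b
  have hp := Real.pi_pos
  apply Real.cos_nonneg_of_neg_pi_div_two_le_of_le <;> nlinarith

/-- The deformation. -/
noncomputable def FF {l : ℕ} (k : Fin l → ℕ) (lam : ℝ) (i0 : Fin l) (t : ℝ)
    (θ : Fin l → AddCircle (2 * Real.pi)) : Fin l → AddCircle (2 * Real.pi) :=
  θ - Pi.single i0 ((t * rr ((lam : AddCircle (2 * Real.pi)) + ∑ i, (k i : ℤ) • θ i) / k i0 : ℝ) :
    AddCircle (2 * Real.pi))

lemma FF_continuous {l : ℕ} (k : Fin l → ℕ) (lam : ℝ) (i0 : Fin l) :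
    Continuous (fun p : ℝ × (Fin l → AddCircle (2 * Real.pi)) => FF k lam i0 p.1 p.2) := by
  unfold FF
  have h1 : Continuous (fun p : ℝ × (Fin l → AddCircle (2 * Real.pi)) =>
      rr ((lam : AddCircle (2 * Real.pi)) + ∑ i, (k i : ℤ) • p.2 i)) :=
    rr_continuous.comp (by fun_prop)
  have h2 : Continuous (fun p : ℝ × (Fin l → AddCircle (2 * Real.pi)) =>
      ((p.1 * rr ((lam : AddCircle (2 * Real.pi)) + ∑ i, (k i : ℤ) • p.2 i) / k i0 : ℝ) :
    AddCircle (2 * Real.pi))) :=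
    (AddCircle.continuous_mk' _).comp ((continuous_fst.mul h1).div_const _)
  exact continuous_snd.sub ((continuous_single i0).comp h2)

lemma FF_sum {l : ℕ} (k : Fin l → ℕ) (hk : ∀ i, 0 < k i) (lam : ℝ) (i0 : Fin l) (t : ℝ)
    (θ : Fin l → AddCircle (2 * Real.pi))
    (h : 0 ≤ Real.cos_periodic.lift
        ((lam : AddCircle (2 * Real.pi)) + ∑ i, (k i : ℤ) • θ i)) :
    (lam : AddCircle (2 * Real.pi)) + ∑ i, (k i : ℤ) • (FF k lam i0 t θ) i =
      (((1 - t) * rr ((lam : AddCircle (2 * Real.pi)) + ∑ i, (k i : ℤ) • θ i) : ℝ) :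
        AddCircle (2 * Real.pi)) := by
  have e := coe_rr _ h
  have hk0 : (k i0 : ℝ) ≠ 0 := by exact_mod_cast (hk i0).ne'
  unfold FF
  set r := rr ((lam : AddCircle (2 * Real.pi)) + ∑ i, (k i : ℤ) • θ i) with hr
  have hs : ∑ i, (k i : ℤ) • (Pi.single i0 ((t * r / k i0 : ℝ) : AddCircle (2 * Real.pi)) :
      Fin l → AddCircle (2 * Real.pi)) i = ((t * r : ℝ) : AddCircle (2 * Real.pi)) := by
    rw [Finset.sum_eq_single i0]
    · rw [Pi.single_eq_same, ← AddCircle.coe_zsmul]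
      congr 1
      rw [zsmul_eq_mul]
      push_cast
      field_simp
    · intro b _ hb
      rw [Pi.single_eq_of_ne hb, smul_zero]
    · simp
  simp only [Pi.sub_apply, smul_sub, Finset.sum_sub_distrib]
  rw [hs, ← add_sub_assoc, ← e, ← AddCircle.coe_sub]
  congr 1
  ring

/-- Let `l ≥ 1`, `k₁,…,k_l` positive integers and `λ ∈ ℝ`.  Consider the
closed subsets of the torus `𝕋^l` (`𝕋 = ℝ/2πℤ`)
`S = {θ | cos(λ + k₁θ₁ + ⋯ + k_lθ_l) ≥ 0}` (well defined since cosine is `2π`-periodic,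
realized via the lift of `cos` to `𝕋`) and `C = {θ | k₁θ₁ + ⋯ + k_lθ_l = [-λ]}`.
Then `C ⊆ S` and the inclusion `C ↪ S` is a homotopy equivalence. -/
theorem stmt11 (l : ℕ) (hl : 1 ≤ l) (k : Fin l → ℕ) (hk : ∀ i, 0 < k i) (lam : ℝ)
    (S C : Set (Fin l → AddCircle (2 * Real.pi)))
    (hS : S = {θ | 0 ≤ Real.cos_periodic.lift
        ((lam : AddCircle (2 * Real.pi)) + ∑ i, (k i : ℤ) • θ i)})
    (hC : C = {θ | ∑ i, (k i : ℤ) • θ i = ((-lam : ℝ) : AddCircle (2 * Real.pi))}) :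
    ∃ h : C ⊆ S, ∃ e : ContinuousMap.HomotopyEquiv C S,
      ⇑e.toFun = Set.inclusion h := by
  subst hS hC
  have i0 : Fin l := ⟨0, hl⟩
  have hx : ∀ θ : Fin l → AddCircle (2 * Real.pi),
      ∑ i, (k i : ℤ) • θ i = ((-lam : ℝ) : AddCircle (2 * Real.pi)) →
      (lam : AddCircle (2 * Real.pi)) + ∑ i, (k i : ℤ) • θ i = ((0 : ℝ) : AddCircle (2 * Real.pi)) := by
    intro θ h
    rw [h, ← AddCircle.coe_add, add_neg_cancel]
  have hsub : {θ : Fin l → AddCircle (2 * Real.pi) |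
        ∑ i, (k i : ℤ) • θ i = ((-lam : ℝ) : AddCircle (2 * Real.pi))} ⊆
      {θ | 0 ≤ Real.cos_periodic.lift
        ((lam : AddCircle (2 * Real.pi)) + ∑ i, (k i : ℤ) • θ i)} := by
    intro θ h
    rw [Set.mem_ofPred_eq, hx θ h, Function.Periodic.lift_coe]
    simp
  refine ⟨hsub, ⟨⟨Set.inclusion hsub, continuous_inclusion hsub⟩,
    ⟨fun θ => ⟨FF k lam i0 1 θ.1, ?_⟩, ?_⟩, ?_, ?_⟩, rfl⟩
  · have := FF_sum k hk lam i0 1 θ.1 θ.2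
    rw [sub_self, zero_mul] at this
    rw [Set.mem_ofPred_eq, AddCircle.coe_neg]
    exact eq_neg_of_add_eq_zero_right this
  · exact ((FF_continuous k lam i0).comp
      (continuous_const.prodMk continuous_subtype_val)).subtype_mk _
  · convert ContinuousMap.Homotopic.refl _ using 1
    ext1 θ
    apply Subtype.ext
    change θ.1 = FF k lam i0 1 θ.1
    rw [FF, hx θ.1 θ.2, rr_coe_aux]
    simp
  · refine ⟨⟨⟨fun p => ⟨FF k lam i0 (1 - p.1) p.2.1, ?_⟩, ?_⟩, ?_, ?_⟩⟩
    · rw [Set.mem_ofPred_eq, FF_sum k hk lam i0 _ _ p.2.2, Function.Periodic.lift_coe]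
      refine cos_mul_rr _ _ ?_ ?_
      · linarith [p.1.2.1]
      · linarith [p.1.2.2]
    · refine ((FF_continuous k lam i0).comp
        (Continuous.prodMk (f := fun p : unitInterval × _ => (1 - (p.1 : ℝ))) ?_ ?_)).subtype_mk _
      · fun_prop
      · exact continuous_subtype_val.comp continuous_snd
    · intro θ
      apply Subtype.ext
      simp
      rfl
    · intro θ
      apply Subtype.ext
      simp [FF]
end
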